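/- arXiv:1110.6802 — 3 statements merged into one kernel-verified Lean document; each statement's English description precedes it below -/
import Mathlib

section
/- Let G be a graph with V(G) ≠ ∅. Then G is a forest (contains no cycles) if and only if every weight w : E(G) → [0,∞) is pseudoultrametrizable. -/
open scoped Classical

open SimpleGraph

/-- A pseudoultrametric on a set `X`. -/
def IsPseudoultrametric {X : Type*} (d : X → X → ℝ) : Prop :=
  (∀ x y, 0 ≤ d x y) ∧ (∀ x, d x x = 0) ∧ (∀ x y, d x y = d y x) ∧
    ∀ x y z, d x y ≤ max (d x z) (d z y)

/-- An ultrametric on a set `X`. -/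
def IsUltrametric {X : Type*} (d : X → X → ℝ) : Prop :=
  IsPseudoultrametric d ∧ ∀ x y, d x y = 0 → x = y

/-- A pseudometric on a set `X`. -/
def IsPseudometric {X : Type*} (d : X → X → ℝ) : Prop :=
  (∀ x y, 0 ≤ d x y) ∧ (∀ x, d x x = 0) ∧ (∀ x y, d x y = d y x) ∧
    ∀ x y z, d x y ≤ d x z + d z y

/-- A metric on a set `X`. -/
def IsMetric {X : Type*} (d : X → X → ℝ) : Prop :=
  IsPseudometric d ∧ ∀ x y, d x y = 0 → x = y

variable {V : Type*}

/-- `d` extends the weight `w` of the weighted graph `(G, w)`. -/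
def ExtendsWeight (G : SimpleGraph V) (w : Sym2 V → ℝ) (d : V → V → ℝ) : Prop :=
  ∀ u v : V, G.Adj u v → d u v = w s(u, v)

/-- The maximal weight of an edge of a walk (`0` for a trivial walk). -/
noncomputable def walkMax {G : SimpleGraph V} (w : Sym2 V → ℝ) {x y : V} (p : G.Walk x y) : ℝ :=
  (p.edges.map w).foldr max 0

/-- The subdominant pseudoultrametric `ρ_w` of a connected weighted graph `(G, w)`. -/
noncomputable def rho (G : SimpleGraph V) (w : Sym2 V → ℝ) (x y : V) : ℝ :=
  if x = y then 0 else sInf {r : ℝ | ∃ p : G.Walk x y, p.IsPath ∧ r = walkMax w p}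

/-- The shortest-path pseudometric `d_w` of a connected weighted graph `(G, w)`. -/
noncomputable def spDist (G : SimpleGraph V) (w : Sym2 V → ℝ) (x y : V) : ℝ :=
  if x = y then 0 else sInf {r : ℝ | ∃ p : G.Walk x y, p.IsPath ∧ r = (p.edges.map w).sum}

lemma le_walkMax_aux {G : SimpleGraph V} (w : Sym2 V → ℝ) {x y : V} (p : G.Walk x y) (r : ℝ) :
    walkMax w p ≤ r ↔ 0 ≤ r ∧ ∀ e ∈ p.edges, w e ≤ r := by
  unfold walkMax
  induction p.edges with
  | nil => simp
  | cons a l ih => simp only [List.map_cons, List.foldr_cons, max_le_iff, ih, List.mem_cons,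
      forall_eq_or_imp]; tauto

/-- `G` is a forest iff every weight on `G` is pseudoultrametrizable. -/
theorem forest_iff_every_weight_pseudoultrametrizable [Nonempty V] (G : SimpleGraph V) :
    G.IsAcyclic ↔
      ∀ w : Sym2 V → ℝ, (∀ e ∈ G.edgeSet, 0 ≤ w e) →
        ∃ d : V → V → ℝ, IsPseudoultrametric d ∧ ExtendsWeight G w d := by
  constructor
  · intro hG w hw
    obtain ⟨T, hGT, -, hT⟩ :=
      SimpleGraph.Connected.exists_isTree_le_of_le_of_isAcyclic (G := (⊤ : SimpleGraph V))
        SimpleGraph.connected_top le_top hG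
    let w' : Sym2 V → ℝ := fun e => if e ∈ G.edgeSet then w e else 0
    choose P hP hU using hT.existsUnique_path
    have key : ∀ {x y : V} (q : T.Walk x y) (r : ℝ), 0 ≤ r → (∀ e ∈ q.edges, w' e ≤ r) →
        walkMax w' (P x y) ≤ r := by
      intro x y q r h0 h
      rw [le_walkMax_aux]
      refine ⟨h0, fun e he => h e ?_⟩
      rw [← hU x y _ q.bypass_isPath] at he
      exact q.edges_bypass_subset_edges he
    have hn : ∀ x y, 0 ≤ walkMax w' (P x y) := fun x y =>
      ((le_walkMax_aux w' (P x y) _).1 le_rfl).1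
    have he : ∀ x y, ∀ e ∈ (P x y).edges, w' e ≤ walkMax w' (P x y) := fun x y =>
      ((le_walkMax_aux w' (P x y) _).1 le_rfl).2
    refine ⟨fun x y => walkMax w' (P x y), ⟨hn, ?_, ?_, ?_⟩, ?_⟩
    · intro x
      exact le_antisymm (key (Walk.nil) 0 le_rfl (by simp)) (hn x x)
    · have : ∀ x y, walkMax w' (P x y) ≤ walkMax w' (P y x) := fun x y =>
        key (P y x).reverse _ (hn _ _) (by simpa using he y x)
      exact fun x y => le_antisymm (this x y) (this y x)
    · intro x y z
      refine key ((P x z).append (P z y)) _ (le_max_of_le_left (hn _ _)) ?_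
      intro e h
      rw [Walk.edges_append, List.mem_append] at h
      rcases h with h | h
      · exact le_max_of_le_left (he _ _ _ h)
      · exact le_max_of_le_right (he _ _ _ h)
    · intro u v huv
      have hp : P u v = (hGT huv).toWalk := (hU u v _ (by simp [huv.ne])).symm
      have h0 : 0 ≤ w s(u, v) := hw _ huv
      simp [hp, walkMax, w', huv, h0]
  · intro h
    rw [isAcyclic_iff_forall_adj_isBridge]
    intro u v huv
    rw [isBridge_iff]
    rintro ⟨p⟩
    obtain ⟨d, ⟨hn, h0, hs, ht⟩, hd⟩ := h (fun e => if e = s(u, v) then 1 else 0)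
      (fun e _ => by split_ifs <;> norm_num)
    have hz : ∀ {a b : V} (q : (G \ fromEdgeSet {s(u, v)}).Walk a b), d a b ≤ 0 := by
      intro a b q
      induction q with
      | nil => exact (h0 _).le
      | @cons a c b hac q ih =>
        refine (ht a b c).trans (max_le ?_ ih)
        have h1 : G.Adj a c := hac.1
        have h2 : s(a, c) ≠ s(u, v) := fun e => hac.2 (by simp [e, h1.ne])
        rw [hd a c h1]
        simp only [if_neg h2, le_refl]
    have := hz p
    rw [hd u v huv] at this
    norm_num at this
end

section
/- Let G be a nonempty connected graph. The following are equivalent: (i) for every strictly positive pseudoultrametrizable weight w : E(G) → [0,∞), the subdominant pseudoultrametric ρ_w is an ultrametric (i.e., ρ_w(x,y) > 0 whenever x ≠ y); (ii) for every pair of distinct vertices u*, v* ∈ V(G) and every sequence (F_j)_{j ∈ ℕ} of paths in G joining u* and v*, there exists an edge {u⁰, v⁰} ∈ E(G) such that for every i > 0 both u⁰ and v⁰ belong to ⋃_{k=1}^{∞} V(F_{i+k}). -/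
open scoped Classical

open SimpleGraph

variable {V : Type*}

theorem walkMax_nonneg_aux {G : SimpleGraph V} (w : Sym2 V → ℝ) {x y : V} (p : G.Walk x y) :
    0 ≤ walkMax w p := by
  induction p with
  | nil => simp [walkMax]
  | cons h p ih =>
    simp only [walkMax, Walk.edges_cons, List.map_cons, List.foldr_cons] at ih ⊢
    exact le_max_of_le_right ih

theorem walkMax_le_aux {G : SimpleGraph V} (w : Sym2 V → ℝ) (c : ℝ) (hc : 0 ≤ c)
    {x y : V} (p : G.Walk x y)
    (h : ∀ a b, a ∈ p.support → b ∈ p.support → w s(a, b) ≤ c) :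
    walkMax w p ≤ c := by
  induction p with
  | nil => simpa [walkMax] using hc
  | cons h' p ih =>
    simp only [walkMax, Walk.edges_cons, List.map_cons, List.foldr_cons] at ih ⊢
    refine max_le (h _ _ (by simp) (by simp)) (ih ?_)
    intro a b ha hb
    exact h a b (by simp [ha]) (by simp [hb])

theorem dist_le_walkMax_aux {G : SimpleGraph V} (w : Sym2 V → ℝ) (d : V → V → ℝ)
    (hd : IsPseudoultrametric d) (he : ExtendsWeight G w d) {x y : V} (p : G.Walk x y) :
    ∀ a ∈ p.support, d x a ≤ walkMax w p := by
  induction p with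
  | nil =>
    intro a ha
    simp only [Walk.support_nil, List.mem_singleton] at ha
    subst ha
    rw [hd.2.1]
    exact walkMax_nonneg_aux _ _
  | @cons x z y h p ih =>
    intro a ha
    rw [Walk.support_cons, List.mem_cons] at ha
    rcases ha with rfl | ha
    · rw [hd.2.1]
      exact walkMax_nonneg_aux _ _
    · have h1 := hd.2.2.2 x a z
      have h2 := ih a ha
      rw [he x z h] at h1
      simp only [walkMax, Walk.edges_cons, List.map_cons, List.foldr_cons] at h2 ⊢
      exact h1.trans (max_le_max le_rfl h2)

theorem exists_vertex_weight_aux {G : SimpleGraph V} {u v : V} (F : ℕ → G.Walk u v) (a : V) :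
    ∃ t : ℝ, 0 ≤ t ∧ (t = 0 → ∀ n, ∃ m > n, a ∈ (F m).support) ∧
      ∀ j : ℕ, a ∈ (F j).support → t ≤ 1 / ((j : ℝ) + 1) := by
  by_cases h : ∀ n, ∃ m > n, a ∈ (F m).support
  · exact ⟨0, le_rfl, fun _ => h, fun j _ => by positivity⟩
  · push Not at h
    obtain ⟨n, hn⟩ := h
    have hp : (0 : ℝ) < 1 / ((n : ℝ) + 1) := by positivity
    refine ⟨1 / ((n : ℝ) + 1), hp.le, fun h0 => absurd h0 hp.ne', fun j hj => ?_⟩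
    have : j ≤ n := by
      by_contra hc
      exact hn j (by omega) hj
    have : (j : ℝ) ≤ n := by exact_mod_cast this
    gcongr

/-- for a nonempty connected graph `G`, the subdominant pseudoultrametric
`ρ_w` is an ultrametric for every strictly positive pseudoultrametrizable weight `w`
iff for all distinct `u*`, `v*` and every sequence of paths joining them there is an
edge both of whose ends lie in all tails `⋃_{k≥1} V(F_{i+k})`. -/
theorem rho_ultrametric_iff [Nonempty V] (G : SimpleGraph V) (hG : G.Connected) :
    (∀ w : Sym2 V → ℝ, (∀ e ∈ G.edgeSet, 0 < w e) →
        (∃ d : V → V → ℝ, IsPseudoultrametric d ∧ ExtendsWeight G w d) →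
        ∀ x y : V, x ≠ y → 0 < rho G w x y) ↔
      (∀ u v : V, u ≠ v → ∀ F : (j : ℕ) → G.Walk u v, (∀ j, (F j).IsPath) →
        ∃ a b : V, G.Adj a b ∧ ∀ i : ℕ, 0 < i →
          (∃ k : ℕ, 1 ≤ k ∧ a ∈ (F (i + k)).support) ∧
          (∃ k : ℕ, 1 ≤ k ∧ b ∈ (F (i + k)).support)) := by
  constructor
  · intro H u v huv F hF
    by_contra hcon
    choose t ht0 ht1 ht2 using exists_vertex_weight_aux F
    let w : Sym2 V → ℝ := Sym2.lift ⟨fun a b => max (t a) (t b), fun a b => max_comm _ _⟩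
    have hw : ∀ a b, w s(a, b) = max (t a) (t b) := fun a b => rfl
    have hpos : ∀ e ∈ G.edgeSet, 0 < w e := by
      intro e he
      induction e using Sym2.ind with
      | _ a b =>
        rw [hw]
        by_contra hle
        have hle := max_le_iff.1 (not_lt.1 hle)
        have ha := ht1 a (le_antisymm hle.1 (ht0 a))
        have hb := ht1 b (le_antisymm hle.2 (ht0 b))
        refine hcon ⟨a, b, he, fun i _ => ⟨?_, ?_⟩⟩
        · obtain ⟨m, hm, hma⟩ := ha i
          obtain ⟨k, rfl⟩ := Nat.exists_eq_add_of_lt hm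
          exact ⟨k + 1, by omega, hma⟩
        · obtain ⟨m, hm, hma⟩ := hb i
          obtain ⟨k, rfl⟩ := Nat.exists_eq_add_of_lt hm
          exact ⟨k + 1, by omega, hma⟩
    have hr := H w hpos ⟨fun x y => if x = y then 0 else max (t x) (t y), ⟨?_, ?_, ?_, ?_⟩, ?_⟩ u v huv
    · rw [rho, if_neg huv] at hr
      obtain ⟨n, hn⟩ := exists_nat_one_div_lt hr
      refine absurd hn (not_lt.2 ?_)
      refine le_trans (b := walkMax w (F n)) (csInf_le ⟨0, ?_⟩ ⟨F n, hF n, rfl⟩)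
        (walkMax_le_aux w _ (by positivity) _ fun a b ha hb => ?_)
      · rintro r ⟨p, -, rfl⟩
        exact walkMax_nonneg_aux _ _
      · rw [hw]
        exact max_le (ht2 a n ha) (ht2 b n hb)
    · intro x y
      have := ht0 x
      dsimp only
      split_ifs
      · exact le_rfl
      · exact le_max_of_le_left this
    · intro x
      simp
    · intro x y
      simp only [max_comm, eq_comm]
    · intro x y z
      have := ht0 x
      have := ht0 y
      have := ht0 z
      dsimp only
      grind
    · intro x y hxy
      simp [hxy.ne, hw]
  · rintro H w hpos ⟨d, hd, he⟩ x y hxy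
    by_contra hr
    rw [rho, if_neg hxy] at hr
    have hne : {r : ℝ | ∃ p : G.Walk x y, p.IsPath ∧ r = walkMax w p}.Nonempty := by
      obtain ⟨p, hp⟩ := (hG.preconnected x y).exists_isPath
      exact ⟨_, p, hp, rfl⟩
    have hF : ∀ n : ℕ, ∃ p : G.Walk x y, p.IsPath ∧ walkMax w p < 1 / ((n : ℝ) + 1) := by
      intro n
      have h0 : (0 : ℝ) < 1 / ((n : ℝ) + 1) := by positivity
      obtain ⟨r, ⟨p, hp, rfl⟩, hlt⟩ := exists_lt_of_csInf_lt hne ((not_lt.1 hr).trans_lt h0)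
      exact ⟨p, hp, hlt⟩
    choose F hFp hFw using hF
    obtain ⟨a, b, hab, hi⟩ := H x y hxy F hFp
    have hwp : 0 < w s(a, b) := hpos _ hab
    obtain ⟨n, hn⟩ := exists_nat_one_div_lt hwp
    have key : ∀ c k, c ∈ (F (n + 1 + k)).support → d x c < w s(a, b) := by
      intro c k hc
      refine (dist_le_walkMax_aux w d hd he _ c hc).trans_lt (((hFw _).trans_le ?_).trans hn)
      have : (n : ℝ) ≤ ((n + 1 + k : ℕ) : ℝ) := by exact_mod_cast (by omega)
      gcongr
    obtain ⟨⟨k, -, hk⟩, ⟨l, -, hl⟩⟩ := hi (n + 1) (by omega)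
    have h1 := hd.2.2.2 a b x
    rw [he a b hab, hd.2.2.1 a x] at h1
    exact absurd h1 (not_le.2 (max_lt (key a k hk) (key b l hl)))
end

section
/- Let G be a nonempty connected graph. The following are equivalent: (i) the subdominant pseudoultrametric ρ_w is an ultrametric for every strictly positive pseudoultrametrizable weight w : E(G) → [0,∞); (ii) the shortest-path pseudometric d_w is a metric for every strictly positive pseudometrizable weight w : E(G) → [0,∞). -/
open scoped Classical

open SimpleGraph

variable {V : Type*}

section helpers

variable {G : SimpleGraph V} {w : Sym2 V → ℝ}

lemma foldr_max_nonneg' (l : List ℝ) : 0 ≤ l.foldr max 0 := by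
  induction l with
  | nil => simp
  | cons a l ih => simp [ih]

lemma walkMax_nonneg {x y : V} (p : G.Walk x y) : 0 ≤ walkMax w p := foldr_max_nonneg' _

lemma walkMax_le {x y : V} (p : G.Walk x y) {c : ℝ} (hc : 0 ≤ c)
    (h : ∀ e ∈ p.edges, w e ≤ c) : walkMax w p ≤ c := by
  unfold walkMax
  generalize p.edges = l at h
  induction l with
  | nil => simpa using hc
  | cons a l ih =>
    simp only [List.map_cons, List.foldr_cons, max_le_iff]
    exact ⟨h a (by simp), ih fun e he => h e (by simp [he])⟩

lemma le_walkMax {x y : V} (p : G.Walk x y) {e : Sym2 V} (he : e ∈ p.edges) :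
    w e ≤ walkMax w p := by
  unfold walkMax
  generalize p.edges = l at he
  induction l with
  | nil => simp at he
  | cons a l ih =>
    simp only [List.map_cons, List.foldr_cons, le_max_iff]
    rcases List.mem_cons.1 he with h | h
    · left; rw [h]
    · right; exact ih h

lemma walkSum_nonneg (hw : ∀ e ∈ G.edgeSet, 0 < w e) {x y : V} (p : G.Walk x y) :
    0 ≤ (p.edges.map w).sum := by
  apply List.sum_nonneg
  intro a ha
  obtain ⟨e, he, rfl⟩ := List.mem_map.1 ha
  exact (hw e (p.edges_subset_edgeSet he)).le

lemma rho_le_walk {x y : V} (p : G.Walk x y) : rho G w x y ≤ walkMax w p := by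
  unfold rho
  split_ifs with h
  · exact walkMax_nonneg p
  · refine le_trans (csInf_le ⟨0, ?_⟩ ⟨p.bypass, p.bypass_isPath, rfl⟩) ?_
    · rintro r ⟨q, -, rfl⟩; exact walkMax_nonneg q
    · exact walkMax_le _ (walkMax_nonneg p) fun e he => le_walkMax p (p.edges_bypass_subset_edges he)

lemma rho_nonneg (x y : V) : 0 ≤ rho G w x y := by
  unfold rho
  split_ifs with h
  · exact le_rfl
  · apply Real.sInf_nonneg
    rintro r ⟨q, -, rfl⟩; exact walkMax_nonneg q

lemma exists_walk_rho (hG : G.Connected) (x y : V) {ε : ℝ} (hε : 0 < ε) :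
    ∃ p : G.Walk x y, walkMax w p < rho G w x y + ε := by
  by_cases h : x = y
  · subst h
    exact ⟨Walk.nil, by simpa [rho, walkMax] using hε⟩
  · obtain ⟨q⟩ := hG.preconnected x y
    have hne : {r : ℝ | ∃ p : G.Walk x y, p.IsPath ∧ r = walkMax w p}.Nonempty :=
      ⟨_, q.bypass, q.bypass_isPath, rfl⟩
    have : sInf {r : ℝ | ∃ p : G.Walk x y, p.IsPath ∧ r = walkMax w p} < rho G w x y + ε := by
      simp only [rho, if_neg h]; linarith
    obtain ⟨r, ⟨p, -, rfl⟩, hr⟩ := exists_lt_of_csInf_lt hne this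
    exact ⟨p, hr⟩

lemma rho_pseudo (hG : G.Connected) : IsPseudoultrametric (rho G w) := by
  have hs : ∀ x y, rho G w x y ≤ rho G w y x := by
    intro x y
    refine le_of_forall_pos_le_add fun ε hε => ?_
    obtain ⟨p, hp⟩ := exists_walk_rho (w := w) hG y x hε
    refine (rho_le_walk p.reverse).trans (le_trans ?_ hp.le)
    exact walkMax_le _ (walkMax_nonneg _) fun e he => le_walkMax p (by simpa using he)
  refine ⟨rho_nonneg, fun x => by simp [rho], fun x y => le_antisymm (hs x y) (hs y x), ?_⟩
  intro x y z
  refine le_of_forall_pos_le_add fun ε hε => ?_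
  obtain ⟨p, hp⟩ := exists_walk_rho (w := w) hG x z hε
  obtain ⟨q, hq⟩ := exists_walk_rho (w := w) hG z y hε
  have h1 := le_max_left (rho G w x z) (rho G w z y)
  have h2 := le_max_right (rho G w x z) (rho G w z y)
  refine (rho_le_walk (p.append q)).trans (walkMax_le _ ?_ ?_)
  · linarith [rho_nonneg (G := G) (w := w) x z]
  · intro e he
    rw [Walk.edges_append, List.mem_append] at he
    rcases he with he | he
    · linarith [le_walkMax (w := w) p he]
    · linarith [le_walkMax (w := w) q he]

lemma spDist_le_walk (hw : ∀ e ∈ G.edgeSet, 0 < w e) {x y : V} (p : G.Walk x y) :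
    spDist G w x y ≤ (p.edges.map w).sum := by
  unfold spDist
  split_ifs with h
  · exact walkSum_nonneg hw p
  · refine le_trans (csInf_le ⟨0, ?_⟩ ⟨p.bypass, p.bypass_isPath, rfl⟩) ?_
    · rintro r ⟨q, -, rfl⟩; exact walkSum_nonneg hw q
    · have hsub : p.bypass.edges.Subperm p.edges :=
        List.Nodup.subperm p.bypass_isPath.isTrail.edges_nodup p.edges_bypass_subset_edges
      obtain ⟨l, hl, hs⟩ := hsub
      rw [← (hl.map w).sum_eq]
      apply (hs.map w).sum_le_sum
      intro a ha
      obtain ⟨e, he, rfl⟩ := List.mem_map.1 ha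
      exact (hw e (p.edges_subset_edgeSet he)).le

lemma spDist_nonneg (hw : ∀ e ∈ G.edgeSet, 0 < w e) (x y : V) : 0 ≤ spDist G w x y := by
  unfold spDist
  split_ifs with h
  · exact le_rfl
  · apply Real.sInf_nonneg
    rintro r ⟨q, -, rfl⟩; exact walkSum_nonneg hw q

lemma exists_walk_spDist (hG : G.Connected) (x y : V) {ε : ℝ} (hε : 0 < ε) :
    ∃ p : G.Walk x y, (p.edges.map w).sum < spDist G w x y + ε := by
  by_cases h : x = y
  · subst h
    exact ⟨Walk.nil, by simpa [spDist] using hε⟩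
  · obtain ⟨q⟩ := hG.preconnected x y
    have hne : {r : ℝ | ∃ p : G.Walk x y, p.IsPath ∧ r = (p.edges.map w).sum}.Nonempty :=
      ⟨_, q.bypass, q.bypass_isPath, rfl⟩
    have : sInf {r : ℝ | ∃ p : G.Walk x y, p.IsPath ∧ r = (p.edges.map w).sum}
        < spDist G w x y + ε := by
      simp only [spDist, if_neg h]; linarith
    obtain ⟨r, ⟨p, -, rfl⟩, hr⟩ := exists_lt_of_csInf_lt hne this
    exact ⟨p, hr⟩

lemma spDist_pseudo (hG : G.Connected) (hw : ∀ e ∈ G.edgeSet, 0 < w e) :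
    IsPseudometric (spDist G w) := by
  have hs : ∀ x y, spDist G w x y ≤ spDist G w y x := by
    intro x y
    refine le_of_forall_pos_le_add fun ε hε => ?_
    obtain ⟨p, hp⟩ := exists_walk_spDist (w := w) hG y x hε
    refine (spDist_le_walk hw p.reverse).trans (le_trans ?_ hp.le)
    simp [Walk.edges_reverse, List.map_reverse, List.sum_reverse]
  refine ⟨spDist_nonneg hw, fun x => by simp [spDist],
    fun x y => le_antisymm (hs x y) (hs y x), ?_⟩
  intro x y z
  refine le_of_forall_pos_le_add fun ε hε => ?_
  obtain ⟨p, hp⟩ := exists_walk_spDist (w := w) hG x z (half_pos hε)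
  obtain ⟨q, hq⟩ := exists_walk_spDist (w := w) hG z y (half_pos hε)
  refine (spDist_le_walk hw (p.append q)).trans ?_
  rw [Walk.edges_append, List.map_append, List.sum_append]
  linarith

/-- The weight `max (f a) (f b)` on the pair `{a, b}`. -/
noncomputable def starWeight (f : V → ℝ) : Sym2 V → ℝ :=
  Sym2.lift ⟨fun a b => max (f a) (f b), fun _ _ => max_comm _ _⟩

lemma starWeight_mk (f : V → ℝ) (a b : V) : starWeight f s(a, b) = max (f a) (f b) := rfl

/-- The star pseudoultrametric. -/
noncomputable def starDist (f : V → ℝ) (a b : V) : ℝ := if a = b then 0 else max (f a) (f b)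

lemma starDist_pseudo (f : V → ℝ) (hf : ∀ v, 0 ≤ f v) : IsPseudoultrametric (starDist f) := by
  have h0 : ∀ x y, 0 ≤ starDist f x y := by
    intro x y
    unfold starDist
    split_ifs
    · exact le_rfl
    · exact le_max_of_le_left (hf x)
  refine ⟨h0, fun x => by simp [starDist], ?_, ?_⟩
  · intro x y
    simp only [starDist, eq_comm (a := x) (b := y), max_comm (f x) (f y)]
  · intro x y z
    by_cases hxy : x = y
    · have : starDist f x y = 0 := by simp [starDist, hxy]
      rw [this]; exact le_max_of_le_left (h0 _ _)
    by_cases hxz : x = z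
    · subst hxz; exact le_max_right _ _
    by_cases hzy : z = y
    · subst hzy; exact le_max_left _ _
    simp only [starDist, if_neg hxy, if_neg hxz, if_neg hzy]
    refine max_le ?_ ?_
    · exact le_max_of_le_left (le_max_left _ _)
    · exact le_max_of_le_right (le_max_right _ _)

lemma starDist_extends (f : V → ℝ) : ExtendsWeight G (starWeight f) (starDist f) := by
  intro u v h
  simp [starDist, h.ne, starWeight_mk]

lemma IsPseudoultrametric.toPseudometric {d : V → V → ℝ} (h : IsPseudoultrametric d) :
    IsPseudometric d := by
  refine ⟨h.1, h.2.1, h.2.2.1, fun x y z => (h.2.2.2 x y z).trans ?_⟩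
  exact max_le_add_of_nonneg (h.1 _ _) (h.1 _ _)

lemma dist_le_walkSum (hw : ∀ e ∈ G.edgeSet, 0 < w e) {d : V → V → ℝ} (hd : IsPseudometric d)
    (hext : ExtendsWeight G w d) {x y : V} (p : G.Walk x y) :
    ∀ v ∈ p.support, d x v ≤ (p.edges.map w).sum := by
  induction p with
  | nil =>
    intro v hv
    rw [Walk.support_nil, List.mem_singleton] at hv
    subst hv
    simp [hd.2.1]
  | @cons a b c h p ih =>
    intro v hv
    rw [Walk.support_cons, List.mem_cons] at hv
    rcases hv with rfl | hv
    · rw [hd.2.1]; exact walkSum_nonneg hw _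
    · have := ih v hv
      have h2 := hd.2.2.2 a v b
      rw [hext a b h] at h2
      simp only [Walk.edges_cons, List.map_cons, List.sum_cons]
      linarith

lemma dist_le_walkMax {d : V → V → ℝ} (hd : IsPseudoultrametric d)
    (hext : ExtendsWeight G w d) {x y : V} (p : G.Walk x y) :
    ∀ v ∈ p.support, d x v ≤ walkMax w p := by
  induction p with
  | nil =>
    intro v hv
    rw [Walk.support_nil, List.mem_singleton] at hv
    subst hv
    simp [hd.2.1, walkMax]
  | @cons a b c h p ih =>
    intro v hv
    rw [Walk.support_cons, List.mem_cons] at hv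
    rcases hv with rfl | hv
    · rw [hd.2.1]; exact walkMax_nonneg _
    · have h1 := ih v hv
      have h2 := hd.2.2.2 a v b
      rw [hext a b h] at h2
      refine h2.trans (max_le (le_walkMax _ (by simp)) (h1.trans ?_))
      exact walkMax_le _ (walkMax_nonneg _) fun e he => le_walkMax _ (by simp [he])

lemma starWeight_le_of_mem {f : V → ℝ} {x y : V} (p : G.Walk x y) {c : ℝ}
    (h : ∀ v ∈ p.support, f v ≤ c) : ∀ e ∈ p.edges, starWeight f e ≤ c := by
  intro e he
  induction e using Sym2.ind with
  | _ a b =>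
    rw [starWeight_mk]
    exact max_le (h a (p.fst_mem_support_of_mem_edges he))
      (h b (p.snd_mem_support_of_mem_edges he))

lemma starWeight_pos {f : V → ℝ} (h : ∀ a b, G.Adj a b → 0 < f a ∨ 0 < f b) :
    ∀ e ∈ G.edgeSet, 0 < starWeight f e := by
  intro e he
  induction e using Sym2.ind with
  | _ a b =>
    rw [starWeight_mk, lt_max_iff]
    exact h a b he

lemma pos_of_adj (hw : ∀ e ∈ G.edgeSet, 0 < w e) {d : V → V → ℝ} (hd : IsPseudometric d)
    (hext : ExtendsWeight G w d) (x : V) (a b : V) (hab : G.Adj a b) :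
    0 < d x a ∨ 0 < d x b := by
  have h1 := hext a b hab
  have h2 := hw s(a, b) hab
  have h3 := hd.2.2.2 a b x
  rw [hd.2.2.1 a x] at h3
  by_contra! h
  linarith [h.1, h.2]

end helpers

/-- for a nonempty connected graph `G`, the subdominant pseudoultrametric
`ρ_w` is an ultrametric for every strictly positive pseudoultrametrizable weight iff the
shortest-path pseudometric `d_w` is a metric for every strictly positive
pseudometrizable weight. -/
theorem rho_ultrametric_iff_spDist_metric [Nonempty V] (G : SimpleGraph V)
    (hG : G.Connected) :
    (∀ w : Sym2 V → ℝ, (∀ e ∈ G.edgeSet, 0 < w e) →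
        (∃ d : V → V → ℝ, IsPseudoultrametric d ∧ ExtendsWeight G w d) →
        IsUltrametric (rho G w)) ↔
      (∀ w : Sym2 V → ℝ, (∀ e ∈ G.edgeSet, 0 < w e) →
        (∃ d : V → V → ℝ, IsPseudometric d ∧ ExtendsWeight G w d) →
        IsMetric (spDist G w)) := by
  constructor
  · intro H w hw hd
    obtain ⟨d, hd, hext⟩ := hd
    refine ⟨spDist_pseudo hG hw, fun x y hxy => ?_⟩
    have hf : ∀ v, 0 ≤ d x v := fun v => hd.1 x v
    refine (H (starWeight (d x)) (starWeight_pos (pos_of_adj hw hd hext x))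
      ⟨_, starDist_pseudo _ hf, starDist_extends _⟩).2 x y (le_antisymm ?_ (rho_nonneg x y))
    refine le_of_forall_pos_le_add fun ε hε => ?_
    obtain ⟨p, hp⟩ := exists_walk_spDist (w := w) hG x y hε
    rw [hxy] at hp
    exact (rho_le_walk p).trans (walkMax_le _ (by linarith)
      (starWeight_le_of_mem p fun v hv => (dist_le_walkSum hw hd hext p v hv).trans hp.le))
  · intro H w hw hd
    obtain ⟨d, hd, hext⟩ := hd
    refine ⟨rho_pseudo hG, fun x y hxy => ?_⟩
    have hP : ∀ n : ℕ, ∃ p : G.Walk x y, walkMax w p < 1 / ((n : ℝ) + 1) := by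
      intro n
      obtain ⟨p, hp⟩ := exists_walk_rho (w := w) hG x y (ε := 1 / ((n : ℝ) + 1)) (by positivity)
      exact ⟨p, by simpa [hxy] using hp⟩
    choose P hP using hP
    set S : ℕ → ℝ := fun n =>
      ∑ m ∈ Finset.range (n + 1), ((m : ℝ) + 1) * (((P m).length : ℝ) + 1) with hS
    have hSpos : ∀ n, 0 < S n := fun n =>
      Finset.sum_pos (fun m _ => by positivity) ⟨0, by simp⟩
    have hSmono : ∀ m n, m ≤ n → S m ≤ S n := by
      intro m n hmn
      refine Finset.sum_le_sum_of_subset_of_nonneg ?_ (fun _ _ _ => by positivity)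
      exact Finset.range_subset_range.2 (by omega)
    have hSle : ∀ n : ℕ, ((n : ℝ) + 1) * (((P n).length : ℝ) + 1) ≤ S n := by
      intro n
      exact Finset.single_le_sum
        (f := fun m : ℕ => ((m : ℝ) + 1) * (((P m).length : ℝ) + 1))
        (fun _ _ => by positivity) (by simp : n ∈ Finset.range (n + 1))
    set f : V → ℝ := fun v => if d x v = 0 then 0 else 1 / S ⌊1 / d x v⌋₊ with hf
    have hf0 : ∀ v, 0 ≤ f v := by
      intro v
      simp only [hf]
      split_ifs
      · exact le_rfl
      · exact (one_div_pos.2 (hSpos _)).le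
    have hfpos : ∀ v, 0 < d x v → 0 < f v := by
      intro v hv
      simp only [hf, if_neg hv.ne']
      exact one_div_pos.2 (hSpos _)
    have hfle : ∀ n, ∀ v ∈ (P n).support, f v ≤ 1 / S n := by
      intro n v hv
      have h1 := (dist_le_walkMax hd hext (P n) v hv).trans_lt (hP n)
      simp only [hf]
      split_ifs with h
      · exact (one_div_pos.2 (hSpos _)).le
      · have h2 : 0 < d x v := lt_of_le_of_ne (hd.1 x v) (Ne.symm h)
        refine one_div_le_one_div_of_le (hSpos _) (hSmono _ _ (Nat.le_floor ?_))
        rw [le_div_iff₀ h2]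
        rw [lt_div_iff₀ (by positivity)] at h1
        nlinarith
    have hpos : ∀ e ∈ G.edgeSet, 0 < starWeight f e := by
      refine starWeight_pos fun a b hab => ?_
      exact (pos_of_adj hw hd.toPseudometric hext x a b hab).imp (hfpos a) (hfpos b)
    refine (H (starWeight f) hpos
      ⟨_, (starDist_pseudo _ hf0).toPseudometric, starDist_extends _⟩).2 x y
      (le_antisymm ?_ (spDist_nonneg hpos x y))
    refine le_of_forall_pos_le_add fun ε hε => ?_
    obtain ⟨n, hn⟩ := exists_nat_one_div_lt hε
    refine (spDist_le_walk hpos (P n)).trans ?_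
    have hsum : (((P n).edges.map (starWeight f)).sum) ≤ ((P n).length : ℝ) * (1 / S n) := by
      have := List.sum_le_card_nsmul ((P n).edges.map (starWeight f)) (1 / S n) (by
        intro a ha
        obtain ⟨e, he, rfl⟩ := List.mem_map.1 ha
        exact starWeight_le_of_mem (P n) (hfle n) e he)
      simpa using this
    have h3 : ((P n).length : ℝ) * (1 / S n) ≤ 1 / ((n : ℝ) + 1) := by
      rw [mul_one_div, div_le_div_iff₀ (hSpos n) (by positivity)]
      have hn0 : (0 : ℝ) ≤ n := n.cast_nonneg
      nlinarith [hSle n]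
    linarith
end
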